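/- arXiv:2304.02985 — 2 statements merged into one kernel-verified Lean document; each statement's English description precedes it below -/
import Mathlib

section
/- The tangent function admits the partial fraction expansion tan(1/z) = Σ_{n ∈ ℕ odd} 8z/(n²π²z² − 4), valid for z ≠ 0 with 1/z not an odd multiple of π/2; equivalently tan w = Σ_{n odd} 8w/(n²π² − 4w²). -/
open Filter Topology Complex in
theorem pair_hasSum (x : ℂ) (hx : x ∈ Complex.integerComplement) :
    HasSum (fun n : ℕ => 1 / (x + n) + 1 / (x - (n + 1))) (Real.pi * Complex.cot (Real.pi * x)) := by
  have h1 : HasSum (fun n : ℕ => 1 / (x - (n + 1)) + 1 / (x + (n + 1)))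
      (Real.pi * Complex.cot (Real.pi * x) - 1 / x) := by
    rw [cot_series_rep' hx]
    exact (summable_cotTerm hx).hasSum
  have hs : Summable (fun n : ℕ => 1 / (x + n) - 1 / (x + ((n + 1 : ℕ) : ℂ))) := by
    have h := (EisensteinSeries.summable_linear_right_add_one_mul_linear_right x 1 1).comp_injective
      (Nat.cast_injective (R := ℤ))
    refine h.congr fun n => ?_
    have a := integerComplement_add_ne_zero hx (n : ℤ)
    have b := integerComplement_add_ne_zero hx ((n : ℤ) + 1)
    push_cast at a b
    have b' : x + n + 1 ≠ 0 := by rwa [add_assoc]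
    simp only [Function.comp]
    push_cast
    rw [one_mul, ← add_assoc, div_sub_div _ _ a b', inv_eq_one_div,
      div_eq_div_iff (mul_ne_zero b' a) (mul_ne_zero a b')]
    ring
  have h2 : HasSum (fun n : ℕ => 1 / (x + n) - 1 / (x + ((n + 1 : ℕ) : ℂ))) (1 / x) := by
    rw [hs.hasSum_iff_tendsto_nat]
    simp_rw [Finset.sum_range_sub' (fun n : ℕ => 1 / (x + (n : ℂ)))]
    have : Tendsto (fun n : ℕ => 1 / (x + (n : ℂ))) atTop (𝓝 0) := by
      simp_rw [one_div]
      refine tendsto_inv₀_cobounded.comp ?_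
      exact (tendsto_const_add_cobounded x).comp
        (tendsto_norm_atTop_iff_cobounded.1 (by simpa using tendsto_natCast_atTop_atTop (R := ℝ)))
    simpa using (tendsto_const_nhds (x := 1 / x)).sub this
  have h := h1.add h2
  rw [sub_add_cancel] at h
  convert h using 2 with n
  push_cast
  ring

/-- Partial fraction expansion of the tangent function:
`tan w = Σ_{n odd} 8w/(n²π² − 4w²)` whenever `cos w ≠ 0`. -/
theorem stmt13 (w : ℝ) (hw : Real.cos w ≠ 0) :
    Real.tan w =
      ∑' n : ℕ, if Odd n then 8 * w / ((n : ℝ) ^ 2 * Real.pi ^ 2 - 4 * w ^ 2) else 0 := by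
  have hpi : (Real.pi : ℂ) ≠ 0 := by exact_mod_cast Real.pi_ne_zero
  have hx : ((w : ℂ) / Real.pi + 1 / 2) ∈ Complex.integerComplement := by
    rw [Complex.mem_integerComplement_iff]
    rintro ⟨n, hn⟩
    apply hw
    have h1 : (n : ℝ) = w / Real.pi + 1 / 2 := by
      apply Complex.ofReal_injective
      push_cast
      exact hn
    have h2 : w = n * Real.pi - Real.pi / 2 := by
      rw [h1]; field_simp; ring
    rw [h2, Real.cos_sub_pi_div_two, Real.sin_int_mul_pi]
  have h := (pair_hasSum _ hx).mul_left (-1 / (Real.pi : ℂ))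
  have hval : -1 / (Real.pi : ℂ) * (Real.pi * Complex.cot (Real.pi * ((w : ℂ) / Real.pi + 1 / 2)))
      = ((Real.tan w : ℝ) : ℂ) := by
    have e : (Real.pi : ℂ) * ((w : ℂ) / Real.pi + 1 / 2) = w + Real.pi / 2 := by field_simp
    rw [e, Complex.cot, Complex.cos_add_pi_div_two, Complex.sin_add_pi_div_two, Complex.ofReal_tan,
      Complex.tan]
    field_simp
  rw [hval] at h
  have h' : HasSum (fun n : ℕ => 8 * w / (((2 * n + 1 : ℕ) : ℝ) ^ 2 * Real.pi ^ 2 - 4 * w ^ 2))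
      (Real.tan w) := by
    rw [← Complex.hasSum_ofReal]
    refine (congrArg (fun f => HasSum f _) (funext fun n => ?_)).mpr h
    have a := Complex.integerComplement_add_ne_zero hx (n : ℤ)
    have b := Complex.integerComplement_add_ne_zero hx (-((n : ℤ) + 1))
    push_cast at a b ⊢
    rw [← sub_eq_add_neg] at b
    have key : ((2 * (n : ℂ) + 1) ^ 2 * Real.pi ^ 2 - 4 * w ^ 2) =
        -4 * (Real.pi : ℂ) ^ 2 * (((w : ℂ) / Real.pi + 1 / 2 + n) *
          ((w : ℂ) / Real.pi + 1 / 2 - (n + 1))) := by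
      field_simp; ring
    have hne : -4 * (Real.pi : ℂ) ^ 2 ≠ 0 := mul_ne_zero (by norm_num) (pow_ne_zero _ hpi)
    rw [key, div_add_div _ _ a b, div_mul_div_comm,
      div_eq_div_iff (mul_ne_zero hne (mul_ne_zero a b)) (mul_ne_zero hpi (mul_ne_zero a b))]
    field_simp
    ring
  have hinj : Function.Injective (fun n : ℕ => 2 * n + 1) := fun a b hab => by
    simp only at hab; omega
  symm
  apply HasSum.tsum_eq
  rw [← hinj.hasSum_iff]
  · convert h' using 2 with n
    simp
  · intro n hn
    rw [if_neg]
    rintro ⟨k, hk⟩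
    exact hn ⟨k, hk.symm⟩
end

section
/- Define the discrete measure ρ on ℝ by ρ({2/(nπ)}) = x⁴/(1+x²) with x = 2/(nπ) for odd integers n (positive and negative), and ρ = 0 elsewhere. Then ρ is a finite symmetric measure and ∫ (1+xz)/(z−x) dρ(x) = z²·tan(1/z) − z for z in the upper half-plane with z ∉ {2/(nπ) : n odd}. -/
open MeasureTheory
open scoped ENNReal

lemma aux_congr {E : Type*} [AddCommMonoid E] [TopologicalSpace E] {f g : ℕ → E} {a b : E}
    (h : HasSum f a) (hf : ∀ n, g n = f n) (ha : b = a) : HasSum g b := by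
  rw [ha, funext hf]
  exact h

lemma aux_mem (x : ℂ) (hx : x.im ≠ 0) : x ∈ Complex.integerComplement := by
  rintro ⟨n, rfl⟩
  simp at hx

lemma aux_tan (x : ℂ) (hx : x.im ≠ 0) :
    HasSum (fun k : ℕ => 2 * (1 / (2 * x - (2 * k + 1)) + 1 / (2 * x + (2 * k + 1))))
      (-(Real.pi * Complex.tan (Real.pi * x))) := by
  have hx2 : (2 * x).im ≠ 0 := by simpa using hx
  have h1 := summable_cotTerm (aux_mem x hx)
  have h2 := summable_cotTerm (aux_mem _ hx2)
  have e1 := cot_series_rep' (aux_mem x hx)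
  have e2 := cot_series_rep' (aux_mem _ hx2)
  have hodd : ∀ k : ℕ, cotTerm (2 * x) (2 * k + 1) = cotTerm x k / 2 := by
    intro k
    have a1 : 2 * x - ((2 * k + 1 : ℕ) + 1) = 2 * (x - (k + 1)) := by push_cast; ring
    have a2 : 2 * x + ((2 * k + 1 : ℕ) + 1) = 2 * (x + (k + 1)) := by push_cast; ring
    unfold cotTerm
    rw [a1, a2, one_div, one_div, mul_inv, mul_inv]
    ring
  have h3 : Summable fun k : ℕ => cotTerm (2 * x) (2 * k) :=
    h2.comp_injective (i := fun k : ℕ => 2 * k) (fun a b h => by simpa using h)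
  have h4 : Summable fun k : ℕ => cotTerm (2 * x) (2 * k + 1) := by
    simp_rw [hodd]; exact h1.div_const 2
  have h5 := tsum_even_add_odd h3 h4
  simp_rw [hodd] at h5
  rw [tsum_div_const] at h5
  have hx0 : x ≠ 0 := by rintro rfl; simp at hx
  have hs : Complex.sin (Real.pi * x) ≠ 0 := by
    rw [Complex.sin_ne_zero_iff]
    intro k hk
    have : x = k := by
      have hp : (Real.pi : ℂ) ≠ 0 := by exact_mod_cast Real.pi_ne_zero
      exact mul_left_cancel₀ hp (by rw [hk]; ring)
    rw [this] at hx; simp at hx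
  have hc : Complex.cos (Real.pi * x) ≠ 0 := by
    rw [Complex.cos_ne_zero_iff]
    intro k hk
    have : x = ((2 * k + 1) / 2 : ℝ) := by
      have hp : (Real.pi : ℂ) ≠ 0 := by exact_mod_cast Real.pi_ne_zero
      exact mul_left_cancel₀ hp (by rw [hk]; push_cast; ring)
    rw [this] at hx; exact hx (Complex.ofReal_im _)
  have ht : Complex.tan (Real.pi * x) = Complex.cot (Real.pi * x)
      - 2 * Complex.cot (Real.pi * (2 * x)) := by
    rw [show (Real.pi : ℂ) * (2 * x) = 2 * (Real.pi * x) by ring, Complex.cot_eq_cos_div_sin,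
      Complex.cot_eq_cos_div_sin, Complex.tan_eq_sin_div_cos, Complex.sin_two_mul,
      Complex.cos_two_mul']
    field_simp
    ring
  have h6 := h3.hasSum.mul_left 2
  refine aux_congr h6 (fun k => ?_) ?_
  · unfold cotTerm; push_cast; rfl
  · have e3 : ∑' k, cotTerm x k = Real.pi * Complex.cot (Real.pi * x) - 1 / x := e1.symm
    have e4 : ∑' k, cotTerm (2 * x) k
      = Real.pi * Complex.cot (Real.pi * (2 * x)) - 1 / (2 * x) := e2.symm
    rw [e3, e4] at h5
    rw [eq_sub_of_add_eq h5, ht]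
    field_simp
    ring

lemma aux_odd : HasSum (fun k : ℕ => 1 / ((2 * k + 1 : ℝ)) ^ 2) (Real.pi ^ 2 / 8) := by
  have h := hasSum_zeta_two
  have h1 : HasSum (fun k : ℕ => (1 : ℝ) / ((2 * k : ℕ) : ℝ) ^ 2) (1 / 4 * (Real.pi ^ 2 / 6)) := by
    refine aux_congr (h.mul_left (1 / 4 : ℝ)) (fun k => ?_) rfl
    push_cast
    rw [one_div, one_div, mul_pow, mul_inv]; norm_num
  have h2 : Summable (fun k : ℕ => (1 : ℝ) / ((2 * k + 1 : ℕ) : ℝ) ^ 2) :=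
    h.summable.comp_injective (i := fun k : ℕ => 2 * k + 1) (fun a b h => by simpa using h)
  have h3 := (HasSum.even_add_odd (f := fun n : ℕ => (1 : ℝ) / (n : ℝ) ^ 2) h1 h2.hasSum).unique h
  have h4 := h2.hasSum
  rw [show ∑' k : ℕ, (1 : ℝ) / ((2 * k + 1 : ℕ) : ℝ) ^ 2 = Real.pi ^ 2 / 8 by linarith] at h4
  refine aux_congr h4 (fun k => ?_) rfl
  push_cast
  rfl

def auxNeg : {m : ℤ // Odd m} ≃ {m : ℤ // Odd m} where
  toFun k := ⟨-k, k.2.neg⟩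
  invFun k := ⟨-k, k.2.neg⟩
  left_inv k := by simp
  right_inv k := by simp

def auxInt : ℤ ≃ {m : ℤ // Odd m} where
  toFun j := ⟨2 * j + 1, ⟨j, rfl⟩⟩
  invFun k := (k : ℤ) / 2
  left_inv j := by simp; omega
  right_inv k := by
    obtain ⟨k, j, rfl⟩ := k
    apply Subtype.ext
    change 2 * ((2 * j + 1) / 2) + 1 = 2 * j + 1
    omega

lemma aux_pair (z : ℂ) (hz : 0 < z.im) (x : ℝ) :
    ((x ^ 4 / (1 + x ^ 2) : ℝ) : ℂ) * ((1 + (x : ℂ) * z) / (z - (x : ℂ)))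
     + ((x ^ 4 / (1 + x ^ 2) : ℝ) : ℂ) * ((1 + ((-x : ℝ) : ℂ) * z) / (z - ((-x : ℝ) : ℂ)))
     = 2 * z ^ 3 * (x ^ 2 / ((z - x) * (z + x))) - 2 * z * x ^ 2 := by
  have h1 : z - x ≠ 0 := by
    intro h; have := congrArg Complex.im h; simp at this; exact hz.ne' this
  have h2 : z + x ≠ 0 := by
    intro h; have := congrArg Complex.im h; simp at this; exact hz.ne' this
  have h3 : (1 + (x : ℂ) ^ 2) ≠ 0 := by
    have : (1 + x ^ 2 : ℝ) ≠ 0 := by positivity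
    exact_mod_cast this
  push_cast
  rw [sub_neg_eq_add]
  field_simp
  ring

/-- The Boolean Lévy measure of the tangent law: the discrete measure `ρ` with atoms
`x = 2/(nπ)` (for odd integers `n`) of mass `x⁴/(1+x²)` is finite and symmetric, and
`∫ (1+xz)/(z−x) dρ(x) = z² tan(1/z) − z` on the upper half-plane. -/
theorem stmt14 :
    let ρ : Measure ℝ := Measure.sum fun k : {m : ℤ // Odd m} =>
      ENNReal.ofReal
          ((2 / (((k : ℤ) : ℝ) * Real.pi)) ^ 4 /
            (1 + (2 / (((k : ℤ) : ℝ) * Real.pi)) ^ 2)) •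
        Measure.dirac (2 / (((k : ℤ) : ℝ) * Real.pi))
    ρ Set.univ ≠ ⊤ ∧
    Measure.map (fun x : ℝ => -x) ρ = ρ ∧
    ∀ z : ℂ, 0 < z.im →
      ∫ x : ℝ, (1 + (x : ℂ) * z) / (z - (x : ℂ)) ∂ρ =
        z ^ 2 * Complex.tan (1 / z) - z := by
  intro ρ
  have hfin : ρ Set.univ ≠ ⊤ := by
    simp only [ρ, Measure.sum_apply _ MeasurableSet.univ, Measure.smul_apply, measure_univ,
      smul_eq_mul, mul_one]
    apply Summable.tsum_ofReal_ne_top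
    have hs : Summable fun k : {m : ℤ // Odd m} => (4 / Real.pi ^ 2) * (1 / ((k : ℤ) : ℝ) ^ 2) :=
      ((Real.summable_one_div_int_pow (p := 2)).2 (by norm_num)).mul_left _ |>.comp_injective
        Subtype.val_injective
    refine Summable.of_nonneg_of_le (fun k => by positivity) (fun k => ?_) hs
    have e : (4 / Real.pi ^ 2) * (1 / ((k : ℤ) : ℝ) ^ 2)
      = (2 / (((k : ℤ) : ℝ) * Real.pi)) ^ 2 := by
      rw [div_pow, mul_pow, div_mul_div_comm, mul_one, mul_comm (Real.pi ^ 2)]; norm_num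
    rw [e]
    generalize 2 / (((k : ℤ) : ℝ) * Real.pi) = y
    rw [div_le_iff₀ (by positivity)]
    nlinarith [sq_nonneg y]
  refine ⟨hfin, ?_, ?_⟩
  · simp only [ρ]
    rw [Measure.map_sum (by fun_prop)]
    conv_rhs => rw [← Measure.sum_comp_equiv auxNeg]
    congr 1
    ext1 k
    rw [Measure.map_smul, Measure.map_dirac]
    have e : 2 / ((((auxNeg k : {m : ℤ // Odd m}) : ℤ) : ℝ) * Real.pi)
      = -(2 / (((k : ℤ) : ℝ) * Real.pi)) := by
      simp [auxNeg, div_neg]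
    simp only [Function.comp, e, even_two.neg_pow, (by decide : Even 4).neg_pow]
  · intro z hz
    have : IsFiniteMeasure ρ := ⟨lt_top_iff_ne_top.2 hfin⟩
    have hne : ∀ x : ℝ, z - x ≠ 0 := by
      intro x h; have := congrArg Complex.im h; simp at this; exact hz.ne' this
    have hz0 : z ≠ 0 := by rintro rfl; simp at hz
    have hint : Integrable (fun x : ℝ => (1 + (x : ℂ) * z) / (z - (x : ℂ))) ρ := by
      refine Integrable.of_bound (Continuous.aestronglyMeasurable ?_)
        (‖z‖ + ‖1 + z ^ 2‖ / z.im) (Filter.Eventually.of_forall fun x => ?_)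
      · exact Continuous.div (by fun_prop) (by fun_prop) hne
      · have e : (1 + (x : ℂ) * z) / (z - (x : ℂ)) = -z + (1 + z ^ 2) / (z - x) := by
          have := hne x
          field_simp
          ring
        rw [e]
        refine (norm_add_le _ _).trans ?_
        rw [norm_neg, norm_div]
        gcongr
        have := Complex.abs_im_le_norm (z - x)
        simp at this
        exact (le_abs_self _).trans this
    have H := hasSum_integral_measure hint
    have H2 := ((auxInt.hasSum_iff.2 H).nat_add_neg_add_one)
    refine H2.unique ?_
    have hpi : (Real.pi : ℂ) ≠ 0 := by exact_mod_cast Real.pi_ne_zero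
    have hx : (1 / (Real.pi * z)).im ≠ 0 := by
      rw [one_div, mul_inv, ← Complex.ofReal_inv, Complex.im_ofReal_mul, Complex.inv_im]
      have : Complex.normSq z ≠ 0 := by simpa using hz0
      have := Real.pi_ne_zero
      have := hz.ne'
      simp; tauto
    have T := (aux_tan _ hx).mul_left (-(z ^ 2 / Real.pi))
    have O := (Complex.hasSum_ofReal.2 aux_odd).mul_left (2 * z * (4 / Real.pi ^ 2))
    convert T.sub O using 1
    · ext n
      have e1 : 2 / ((((auxInt (n : ℤ) : {m : ℤ // Odd m}) : ℤ) : ℝ) * Real.pi)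
        = 2 / ((2 * n + 1) * Real.pi) := by simp [auxInt]
      have e2 : 2 / ((((auxInt (-((n : ℤ) + 1)) : {m : ℤ // Odd m}) : ℤ) : ℝ) * Real.pi)
        = -(2 / ((2 * n + 1) * Real.pi)) := by
        rw [← div_neg, ← neg_mul]; simp only [auxInt, Equiv.coe_fn_mk]; push_cast; ring_nf
      simp only [Function.comp, integral_smul_measure, integral_dirac, e1, e2, even_two.neg_pow,
        (by decide : Even 4).neg_pow]
      rw [ENNReal.toReal_ofReal (by positivity), Complex.real_smul, Complex.real_smul,
        aux_pair z hz]
      have hm : (2 * n + 1 : ℂ) ≠ 0 := by exact_mod_cast (by omega : 2 * n + 1 ≠ 0)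
      have k1 := hne (2 / ((2 * n + 1) * Real.pi))
      have k2 := hne (-(2 / ((2 * n + 1) * Real.pi)))
      push_cast at k1 k2 ⊢
      generalize (2 * n + 1 : ℂ) = m at *
      have l1 : z * (m * Real.pi) - 2 ≠ 0 := by
        intro h; apply k1; field_simp; linear_combination h
      have l2 : z * (m * Real.pi) + 2 ≠ 0 := by
        intro h; apply k2; field_simp; linear_combination h
      have q1 : z - 2 / (m * Real.pi) = (z * (m * Real.pi) - 2) / (m * Real.pi) := by
        field_simp
      have q2 : z + 2 / (m * Real.pi) = (z * (m * Real.pi) + 2) / (m * Real.pi) := by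
        field_simp
      have q3 : 2 * (1 / (Real.pi * z)) - m = -(z * (m * Real.pi) - 2) / (Real.pi * z) := by
        field_simp; ring
      have q4 : 2 * (1 / (Real.pi * z)) + m = (z * (m * Real.pi) + 2) / (Real.pi * z) := by
        field_simp; ring
      rw [q1, q2, q3, q4]
      have l3 : -(z * (m * Real.pi) - 2) ≠ 0 := neg_ne_zero.2 l1
      rw [one_div_div, one_div_div, div_neg]
      generalize hA : z * (m * Real.pi) - 2 = A at *
      generalize hB : z * (m * Real.pi) + 2 = B at *
      have hBA : B = A + 4 := by rw [← hA, ← hB]; ring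
      field_simp
      rw [hBA]
      ring
    · have : (Real.pi : ℂ) * (1 / (Real.pi * z)) = 1 / z := by field_simp
      rw [this]
      push_cast
      field_simp
      ring
end
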